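/- Let N = 5 and fix a null frame (ℓ, n, m_2, m_3, m_4) of ℝ^5. Then a Weyl tensor W on ℝ^5 of pure boost weight zero (i.e., all frame components of nonzero boost weight vanish; the type D form) is uniquely determined by the 3×3 matrix Φ_{ij} = W(ℓ, m_i, n, m_j) (2 ≤ i,j ≤ 4): the linear map W ↦ Φ from the space of pure boost-weight-zero Weyl tensors to the space of real 3×3 matrices is injective, and hence (both spaces being 9-dimensional) a linear isomorphism. -/

import Mathlib

/-- The Minkowski symmetric bilinear form of signature `(-,+,…,+)` on `ℝ^N`. -/
def eta {N : ℕ} (x y : Fin N → ℝ) : ℝ :=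
  ∑ a : Fin N, (if (a : ℕ) = 0 then -(x a * y a) else x a * y a)

/-- A null frame `(ℓ, n, m_2, …, m_{N-1})` of `ℝ^N`: a basis consisting of two null
vectors `ℓ = f 0`, `n = f 1` with `η(ℓ,n) = 1` and spacelike vectors `m_i = f i`
(`2 ≤ i`) orthonormal and orthogonal to `ℓ` and `n`. -/
def IsNullFrame {N : ℕ} [NeZero N] (f : Fin N → Fin N → ℝ) : Prop :=
  LinearIndependent ℝ f ∧
  eta (f 0) (f 0) = 0 ∧ eta (f 1) (f 1) = 0 ∧ eta (f 0) (f 1) = 1 ∧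
  (∀ i j : Fin N, 2 ≤ (i : ℕ) → 2 ≤ (j : ℕ) →
      eta (f i) (f j) = if i = j then 1 else 0) ∧
  (∀ i : Fin N, 2 ≤ (i : ℕ) → eta (f 0) (f i) = 0 ∧ eta (f 1) (f i) = 0)

/-- Boost weight of a frame index: `b_0 = 1`, `b_1 = -1`, `b_i = 0` for spatial `i`. -/
def bw {N : ℕ} (A : Fin N) : ℤ :=
  if (A : ℕ) = 0 then 1 else if (A : ℕ) = 1 then -1 else 0

/-- A Weyl tensor on `ℝ^N`: a 4-linear form with the pair symmetries
`W(x,y,z,w) = -W(y,x,z,w) = W(z,w,x,y)`, the first Bianchi identity, and all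
`η`-traces zero (the standard basis being `η`-orthonormal, the `η`-trace of
`(u,v) ↦ W(u,x,v,y)` is `∑ₐ η^{aa} W(eₐ,x,eₐ,y)` with `η^{00} = -1`, `η^{aa} = 1`). -/
def IsWeyl {N : ℕ} (W : MultilinearMap ℝ (fun _ : Fin 4 => (Fin N → ℝ)) ℝ) : Prop :=
  (∀ x y z w : Fin N → ℝ, W ![y, x, z, w] = - W ![x, y, z, w]) ∧
  (∀ x y z w : Fin N → ℝ, W ![z, w, x, y] = W ![x, y, z, w]) ∧
  (∀ x y z w : Fin N → ℝ,
    W ![x, y, z, w] + W ![x, z, w, y] + W ![x, w, y, z] = 0) ∧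
  (∀ x y : Fin N → ℝ,
    ∑ a : Fin N, (if (a : ℕ) = 0 then (-1 : ℝ) else 1) *
      W ![Pi.single a 1, x, Pi.single a 1, y] = 0)

/-- The real vector space of Weyl tensors on `ℝ^N`, as a submodule of the space of
4-linear forms. -/
noncomputable def weylSubmodule (N : ℕ) :
    Submodule ℝ (MultilinearMap ℝ (fun _ : Fin 4 => (Fin N → ℝ)) ℝ) where
  carrier := {W | IsWeyl W}
  add_mem' := by
    rintro W V ⟨w1, w2, w3, w4⟩ ⟨v1, v2, v3, v4⟩
    refine ⟨fun x y z w => ?_, fun x y z w => ?_, fun x y z w => ?_, fun x y => ?_⟩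
    · simp only [MultilinearMap.add_apply]
      rw [w1 x y z w, v1 x y z w]; ring
    · simp only [MultilinearMap.add_apply]
      rw [w2 x y z w, v2 x y z w]
    · simp only [MultilinearMap.add_apply]
      have h1 := w3 x y z w; have h2 := v3 x y z w; linarith
    · simp only [MultilinearMap.add_apply, mul_add, Finset.sum_add_distrib]
      rw [w4 x y, v4 x y]; ring
  zero_mem' := by
    refine ⟨fun x y z w => ?_, fun x y z w => ?_, fun x y z w => ?_, fun x y => ?_⟩ <;>
      simp
  smul_mem' := by
    rintro c W ⟨w1, w2, w3, w4⟩
    refine ⟨fun x y z w => ?_, fun x y z w => ?_, fun x y z w => ?_, fun x y => ?_⟩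
    · simp only [MultilinearMap.smul_apply, smul_eq_mul]
      rw [w1 x y z w]; ring
    · simp only [MultilinearMap.smul_apply, smul_eq_mul]
      rw [w2 x y z w]
    · simp only [MultilinearMap.smul_apply, smul_eq_mul]
      have h1 := w3 x y z w; linear_combination c * h1
    · simp only [MultilinearMap.smul_apply, smul_eq_mul]
      have h : ∀ a : Fin N,
          (if (a : ℕ) = 0 then (-1 : ℝ) else 1) *
              (c * W ![Pi.single a 1, x, Pi.single a 1, y])
            = c * ((if (a : ℕ) = 0 then (-1 : ℝ) else 1) *
              W ![Pi.single a 1, x, Pi.single a 1, y]) := fun a => by ring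
      simp_rw [h]
      rw [← Finset.mul_sum, w4 x y, mul_zero]

/-- The subspace of Weyl tensors of pure boost weight `b` with respect to the frame
`f`: all frame components of boost weight different from `b` vanish. -/
noncomputable def weylPure (N : ℕ) (f : Fin N → Fin N → ℝ) (b : ℤ) :
    Submodule ℝ (weylSubmodule N) where
  carrier := {W | ∀ A : Fin 4 → Fin N, (∑ k, bw (A k)) ≠ b →
    W.val (fun k => f (A k)) = 0}
  add_mem' := by
    intro W V hW hV A hA
    simp only [Submodule.coe_add, MultilinearMap.add_apply, hW A hA, hV A hA, add_zero]
  zero_mem' := by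
    intro A hA
    simp
  smul_mem' := by
    intro c W hW A hA
    simp only [Submodule.coe_smul, MultilinearMap.smul_apply, hW A hA, smul_zero]

open Module

/-- The Gram matrix of a null frame of `ℝ^5`; it is its own inverse. -/
def nullGram : Matrix (Fin 5) (Fin 5) ℝ :=
  !![0, 1, 0, 0, 0; 1, 0, 0, 0, 0; 0, 0, 1, 0, 0; 0, 0, 0, 1, 0; 0, 0, 0, 0, 1]

lemma nullGram_mul_self : nullGram * nullGram = 1 := by
  ext i j
  fin_cases i <;> fin_cases j <;> simp [nullGram, Matrix.mul_apply, Fin.sum_univ_five]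

/-- The matrix of `η` in the standard basis of `ℝ^5`. -/
def minkowski : Matrix (Fin 5) (Fin 5) ℝ :=
  Matrix.diagonal fun a => if (a : ℕ) = 0 then -1 else 1

lemma minkowski_mul_self : minkowski * minkowski = 1 := by
  rw [minkowski, Matrix.diagonal_mul_diagonal, ← Matrix.diagonal_one]
  congr 1
  ext a
  split_ifs <;> simp

lemma eta_comm {N : ℕ} (x y : Fin N → ℝ) : eta x y = eta y x := by
  simp only [eta, mul_comm]

lemma IsNullFrame.gram {f : Fin 5 → Fin 5 → ℝ} (hf : IsNullFrame f) (i j : Fin 5) :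
    eta (f i) (f j) = nullGram i j := by
  obtain ⟨-, h00, h11, h01, hm, h⟩ := hf
  have h10 : eta (f 1) (f 0) = 1 := by rw [eta_comm, h01]
  have h' : ∀ i : Fin 5, 2 ≤ (i : ℕ) → eta (f i) (f 0) = 0 ∧ eta (f i) (f 1) = 0 :=
    fun i hi => by rw [eta_comm, (h i hi).1, eta_comm, (h i hi).2]; simp
  fin_cases i <;> fin_cases j <;> simp [nullGram, *]

/-- The completeness relation: the inverse metric expanded in a null frame. -/
lemma IsNullFrame.completeness {f : Fin 5 → Fin 5 → ℝ} (hf : IsNullFrame f) :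
    (Matrix.of f).transpose * nullGram * Matrix.of f = minkowski := by
  have h1 : Matrix.of f * minkowski * (Matrix.of f).transpose = nullGram := by
    ext i j
    rw [← hf.gram i j, Matrix.mul_apply]
    simp only [minkowski, Matrix.mul_diagonal, Matrix.transpose_apply, Matrix.of_apply, eta]
    refine Finset.sum_congr rfl fun a _ => ?_
    split_ifs <;> ring
  have h2 : Matrix.of f * (minkowski * (Matrix.of f).transpose * nullGram) = 1 := by
    rw [← nullGram_mul_self]
    nth_rewrite 2 [← h1]
    simp only [Matrix.mul_assoc]
  have h3 := mul_eq_one_comm.mp h2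
  calc _ = minkowski * minkowski * ((Matrix.of f).transpose * nullGram * Matrix.of f) := by
        rw [minkowski_mul_self, one_mul]
    _ = minkowski * (minkowski * (Matrix.of f).transpose * nullGram * Matrix.of f) := by
        simp only [Matrix.mul_assoc]
    _ = minkowski := by rw [h3, mul_one]

lemma update_vec_four {α : Type*} (a b c d x : α) :
    Function.update ![a, b, c, d] 0 x = ![x, b, c, d] ∧
    Function.update ![a, b, c, d] 1 x = ![a, x, c, d] ∧
    Function.update ![a, b, c, d] 2 x = ![a, b, x, d] ∧
    Function.update ![a, b, c, d] 3 x = ![a, b, c, x] := by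
  refine ⟨?_, ?_, ?_, ?_⟩ <;> ext k <;> fin_cases k <;> rfl

/-- A 4-linear form as a bilinear form in its second and fourth arguments. -/
def bilinSndFourth {V : Type*} [AddCommGroup V] [Module ℝ V]
    (W : MultilinearMap ℝ (fun _ : Fin 4 => V) ℝ) (u v : V) : V →ₗ[ℝ] V →ₗ[ℝ] ℝ :=
  LinearMap.mk₂ ℝ (fun x y => W ![u, x, v, y])
    (fun x x' y => by
      simpa only [update_vec_four] using W.map_update_add ![u, 0, v, y] 1 x x')
    (fun c x y => by
      simpa only [update_vec_four] using W.map_update_smul ![u, 0, v, y] 1 c x)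
    (fun x y y' => by
      simpa only [update_vec_four] using W.map_update_add ![u, x, v, 0] 3 y y')
    (fun c x y => by
      simpa only [update_vec_four] using W.map_update_smul ![u, x, v, 0] 3 c y)

/-- A 4-linear form as a bilinear form in its first and third arguments. -/
def bilinFstThird {V : Type*} [AddCommGroup V] [Module ℝ V]
    (W : MultilinearMap ℝ (fun _ : Fin 4 => V) ℝ) (x y : V) : V →ₗ[ℝ] V →ₗ[ℝ] ℝ :=
  LinearMap.mk₂ ℝ (fun u v => W ![u, x, v, y])
    (fun u u' v => by
      simpa only [update_vec_four] using W.map_update_add ![0, x, v, y] 0 u u')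
    (fun c u v => by
      simpa only [update_vec_four] using W.map_update_smul ![0, x, v, y] 0 c u)
    (fun u v v' => by
      simpa only [update_vec_four] using W.map_update_add ![u, x, 0, y] 2 v v')
    (fun c u v => by
      simpa only [update_vec_four] using W.map_update_smul ![u, x, 0, y] 2 c v)

/-- The `η`-trace of a bilinear form, computed in a null frame. -/
lemma IsNullFrame.trace_eq {f : Fin 5 → Fin 5 → ℝ} (hf : IsNullFrame f)
    (B : (Fin 5 → ℝ) →ₗ[ℝ] (Fin 5 → ℝ) →ₗ[ℝ] ℝ) :
    ∑ a : Fin 5, (if (a : ℕ) = 0 then (-1 : ℝ) else 1) * B (Pi.single a 1) (Pi.single a 1) =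
      B (f 0) (f 1) + B (f 1) (f 0) + B (f 2) (f 2) + B (f 3) (f 3) + B (f 4) (f 4) := by
  have hB : ∀ u v : Fin 5 → ℝ,
      B u v = ∑ a, ∑ b, u a * v b * B (Pi.single a 1) (Pi.single b 1) := fun u v => by
    conv_lhs => rw [pi_eq_sum_univ' u, pi_eq_sum_univ' v]
    simp only [map_sum, map_smul, LinearMap.sum_apply, LinearMap.smul_apply, smul_eq_mul,
      Finset.mul_sum, mul_assoc]
    rw [Finset.sum_comm]
    refine Finset.sum_congr rfl fun a _ => Finset.sum_congr rfl fun b _ => ?_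
    ring
  have hG : ∀ a b : Fin 5, f 0 a * f 1 b + f 1 a * f 0 b + f 2 a * f 2 b + f 3 a * f 3 b +
      f 4 a * f 4 b = if a = b then (if (a : ℕ) = 0 then (-1 : ℝ) else 1) else 0 := fun a b => by
    have h := congrFun (congrFun hf.completeness a) b
    rw [minkowski, Matrix.diagonal_apply] at h
    rw [← h]
    simp [Matrix.mul_apply, Fin.sum_univ_five, nullGram]
    ring
  rw [hB (f 0), hB (f 1), hB (f 2), hB (f 3), hB (f 4)]
  simp only [← Finset.sum_add_distrib, ← add_mul, hG]
  simp

/-- The vectors of a null frame, as a basis of `ℝ^5`. -/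
noncomputable def IsNullFrame.basis {f : Fin 5 → Fin 5 → ℝ} (hf : IsNullFrame f) :
    Basis (Fin 5) ℝ (Fin 5 → ℝ) :=
  basisOfLinearIndependentOfCardEqFinrank hf.1 (by simp)

lemma IsNullFrame.basis_apply {f : Fin 5 → Fin 5 → ℝ} (hf : IsNullFrame f) (i : Fin 5) :
    hf.basis i = f i := by
  simp [IsNullFrame.basis]

lemma comp_vec_four {α β : Type*} (f : α → β) (A : Fin 4 → α) :
    (fun k => f (A k)) = ![f (A 0), f (A 1), f (A 2), f (A 3)] := by
  ext k
  fin_cases k <;> rfl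

/-- Two 4-linear forms with the same frame components agree. -/
lemma IsNullFrame.ext {f : Fin 5 → Fin 5 → ℝ} (hf : IsNullFrame f)
    {W V : MultilinearMap ℝ (fun _ : Fin 4 => (Fin 5 → ℝ)) ℝ}
    (h : ∀ p q r s, W ![f p, f q, f r, f s] = V ![f p, f q, f r, f s]) : W = V := by
  refine Basis.ext_multilinear (fun _ => hf.basis) fun A => ?_
  simp only [hf.basis_apply]
  rw [comp_vec_four f A]
  exact h _ _ _ _

/-- The 4-linear form with prescribed frame components. -/
noncomputable def IsNullFrame.ofComponents {f : Fin 5 → Fin 5 → ℝ} (hf : IsNullFrame f)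
    (C : Fin 5 → Fin 5 → Fin 5 → Fin 5 → ℝ) :
    MultilinearMap ℝ (fun _ : Fin 4 => (Fin 5 → ℝ)) ℝ :=
  ∑ A : Fin 4 → Fin 5, C (A 0) (A 1) (A 2) (A 3) •
    (MultilinearMap.mkPiAlgebra ℝ (Fin 4) ℝ).compLinearMap fun k => hf.basis.coord (A k)

lemma IsNullFrame.ofComponents_apply {f : Fin 5 → Fin 5 → ℝ} (hf : IsNullFrame f)
    (C : Fin 5 → Fin 5 → Fin 5 → Fin 5 → ℝ) (p q r s : Fin 5) :
    hf.ofComponents C ![f p, f q, f r, f s] = C p q r s := by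
  have h : ∀ i j, hf.basis.repr (f i) j = if i = j then 1 else 0 := fun i j => by
    rw [← hf.basis_apply, hf.basis.repr_self, Finsupp.single_apply]
  simp only [ofComponents, sum_apply, smul_apply,
    MultilinearMap.compLinearMap_apply, MultilinearMap.mkPiAlgebra_apply, Basis.coord_apply,
    Fin.prod_univ_four, smul_eq_mul]
  rw [Finset.sum_eq_single ![p, q, r, s]]
  · simp [h]
  · intro A _ hA
    simp only [Matrix.cons_val, h, mul_ite, mul_one, mul_zero]
    split_ifs with h3 h2 h1 h0 <;> try rfl
    refine absurd ?_ hA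
    ext k
    fin_cases k <;> simp [*]
  · simp

/-- The symmetries of a Weyl tensor, for the components in a null frame of `ℝ^5`. -/
structure IsWeylComponents (C : Fin 5 → Fin 5 → Fin 5 → Fin 5 → ℝ) : Prop where
  antisymm : ∀ p q r s, C q p r s = -C p q r s
  pair_symm : ∀ p q r s, C r s p q = C p q r s
  bianchi : ∀ p q r s, C p q r s + C p r s q + C p s q r = 0
  trace : ∀ q s, C 0 q 1 s + C 1 q 0 s + C 2 q 2 s + C 3 q 3 s + C 4 q 4 s = 0

lemma IsWeyl.components {f : Fin 5 → Fin 5 → ℝ} (hf : IsNullFrame f)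
    {W : MultilinearMap ℝ (fun _ : Fin 4 => (Fin 5 → ℝ)) ℝ} (hW : IsWeyl W) :
    IsWeylComponents fun p q r s => W ![f p, f q, f r, f s] where
  antisymm _ _ _ _ := hW.1 _ _ _ _
  pair_symm _ _ _ _ := hW.2.1 _ _ _ _
  bianchi _ _ _ _ := hW.2.2.1 _ _ _ _
  trace q s := (hf.trace_eq (bilinFstThird W (f q) (f s))).symm.trans (hW.2.2.2 (f q) (f s))

lemma IsWeylComponents.isWeyl {f : Fin 5 → Fin 5 → ℝ} (hf : IsNullFrame f)
    {W : MultilinearMap ℝ (fun _ : Fin 4 => (Fin 5 → ℝ)) ℝ}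
    (hW : IsWeylComponents fun p q r s => W ![f p, f q, f r, f s]) : IsWeyl W := by
  have hvec : ∀ (σ : Equiv.Perm (Fin 4)) (x y z w : Fin 5 → ℝ),
      W.domDomCongr σ ![x, y, z, w] = W ![![x, y, z, w] (σ 0), ![x, y, z, w] (σ 1),
        ![x, y, z, w] (σ 2), ![x, y, z, w] (σ 3)] := fun σ x y z w => by
    rw [MultilinearMap.domDomCongr_apply, ← comp_vec_four]
  refine ⟨fun x y z w => ?_, fun x y z w => ?_, fun x y z w => ?_, fun x y => ?_⟩
  · have h : W.domDomCongr (Equiv.swap 0 1) = -W := hf.ext fun p q r s => by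
      rw [hvec]
      exact hW.antisymm p q r s
    have h' := DFunLike.congr_fun h ![x, y, z, w]
    rw [hvec] at h'
    exact h'
  · have h : W.domDomCongr (Equiv.swap 0 2 * Equiv.swap 1 3) = W := hf.ext fun p q r s => by
      rw [hvec]
      exact hW.pair_symm p q r s
    have h' := DFunLike.congr_fun h ![x, y, z, w]
    rw [hvec] at h'
    exact h'
  · have h : W + W.domDomCongr (Equiv.swap 1 2 * Equiv.swap 2 3) +
        W.domDomCongr (Equiv.swap 2 3 * Equiv.swap 1 2) = 0 := hf.ext fun p q r s => by
      rw [add_apply, add_apply, hvec, hvec]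
      exact hW.bianchi p q r s
    have h' := DFunLike.congr_fun h ![x, y, z, w]
    rw [add_apply, add_apply, hvec, hvec] at h'
    exact h'
  · refine (hf.trace_eq (bilinFstThird W x y)).trans ?_
    have h : bilinSndFourth W (f 0) (f 1) + bilinSndFourth W (f 1) (f 0) +
        bilinSndFourth W (f 2) (f 2) + bilinSndFourth W (f 3) (f 3) +
        bilinSndFourth W (f 4) (f 4) = 0 := by
      refine LinearMap.ext_basis hf.basis hf.basis fun q s => ?_
      rw [hf.basis_apply, hf.basis_apply]
      exact hW.trace q s
    exact DFunLike.congr_fun (DFunLike.congr_fun h x) y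

lemma IsWeylComponents.sub {C D : Fin 5 → Fin 5 → Fin 5 → Fin 5 → ℝ} (hC : IsWeylComponents C)
    (hD : IsWeylComponents D) : IsWeylComponents fun p q r s => C p q r s - D p q r s where
  antisymm p q r s := by linarith [hC.antisymm p q r s, hD.antisymm p q r s]
  pair_symm p q r s := by linarith [hC.pair_symm p q r s, hD.pair_symm p q r s]
  bianchi p q r s := by linarith [hC.bianchi p q r s, hD.bianchi p q r s]
  trace q s := by linarith [hC.trace q s, hD.trace q s]

/-- Components of boost weight zero with `C_{0i1j} = 0` vanish identically. -/
lemma IsWeylComponents.eq_zero {C : Fin 5 → Fin 5 → Fin 5 → Fin 5 → ℝ} (hC : IsWeylComponents C)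
    (hb : ∀ p q r s, bw p + bw q + bw r + bw s ≠ 0 → C p q r s = 0)
    (h0 : ∀ i j : Fin 5, 2 ≤ (i : ℕ) → 2 ≤ (j : ℕ) → C 0 i 1 j = 0) (p q r s : Fin 5) :
    C p q r s = 0 := by
  have hanti' : ∀ p q r s, C p q s r = -C p q r s := fun p q r s => by
    rw [← hC.pair_symm, hC.antisymm, hC.pair_symm]
  have hdiag : ∀ p r s, C p p r s = 0 := fun p r s => by linarith [hC.antisymm p p r s]
  have h0' : ∀ i j : Fin 5, 2 ≤ (i : ℕ) → 2 ≤ (j : ℕ) → C 1 i 0 j = 0 := fun i j hi hj => by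
    rw [← hC.pair_symm, h0 j i hj hi]
  have h01 : ∀ i j : Fin 5, 2 ≤ (i : ℕ) → 2 ≤ (j : ℕ) → C 0 1 i j = 0 := fun i j hi hj => by
    linarith [hC.bianchi 0 1 i j, hanti' 0 i 1 j, h0 i j hi hj, h0 j i hj hi]
  have h01' : ∀ i j : Fin 5, 2 ≤ (i : ℕ) → 2 ≤ (j : ℕ) → C i j 0 1 = 0 := fun i j hi hj => by
    rw [← hC.pair_symm, h01 i j hi hj]
  have hflip : ∀ p q r s, C q p s r = C p q r s := fun p q r s => by
    rw [hanti', hC.antisymm, neg_neg]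
  have h0101 : C 0 1 0 1 = 0 := by
    have := hC.trace 0 1
    rw [hdiag, hC.antisymm 0 1, hC.antisymm 0 2, hC.antisymm 0 3, hC.antisymm 0 4,
      hanti' 0 2 1 2, hanti' 0 3 1 3, hanti' 0 4 1 4, h0 2 2, h0 3 3, h0 4 4] at this <;> simp at *
    exact this
  have hric : ∀ i j : Fin 5, 2 ≤ (i : ℕ) → 2 ≤ (j : ℕ) →
      C 2 i 2 j + C 3 i 3 j + C 4 i 4 j = 0 := fun i j hi hj => by
    have := hC.trace i j
    rwa [h0 i j hi hj, h0' i j hi hj, zero_add, zero_add] at this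
  have hsp : C 2 3 2 3 = 0 ∧ C 2 4 2 4 = 0 ∧ C 3 4 3 4 = 0 ∧ C 2 3 2 4 = 0 ∧ C 2 3 3 4 = 0 ∧
      C 2 4 3 4 = 0 := by
    have e22 := hric 2 2 (by simp) (by simp)
    have e33 := hric 3 3 (by simp) (by simp)
    have e44 := hric 4 4 (by simp) (by simp)
    have e23 := hric 2 3 (by simp) (by simp)
    have e24 := hric 2 4 (by simp) (by simp)
    have e34 := hric 3 4 (by simp) (by simp)
    have hdiag' : ∀ p r s, C r s p p = 0 := fun p r s => by rw [← hC.pair_symm, hdiag]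
    simp only [hdiag, hdiag', hflip 2 3 2 3, hflip 2 4 2 4, hflip 3 4 3 4, hflip 2 4 3 4,
      hC.antisymm 2 3 3 4] at e22 e33 e44 e23 e24 e34
    refine ⟨?_, ?_, ?_, ?_, ?_, ?_⟩ <;> linarith
  obtain ⟨a1, a2, a3, a4, a5, a6⟩ := hsp
  have b4 := (hC.pair_symm 2 3 2 4).trans a4
  have b5 := (hC.pair_symm 2 3 3 4).trans a5
  have b6 := (hC.pair_symm 2 4 3 4).trans a6
  have key : ∀ p q r s : Fin 5, p < q → r < s → C p q r s = 0 := by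
    intro p q r s hpq hrs
    by_cases hw : bw p + bw q + bw r + bw s = 0
    · fin_cases p <;> fin_cases q <;> first | exact absurd hpq (by decide) | skip
      all_goals fin_cases r <;> fin_cases s <;> first
        | exact absurd hrs (by decide)
        | exact absurd hw (by decide)
        | assumption
        | exact h0 _ _ (by decide) (by decide)
        | exact h0' _ _ (by decide) (by decide)
        | exact h01 _ _ (by decide) (by decide)
        | exact h01' _ _ (by decide) (by decide)
    · exact hb _ _ _ _ hw
  have key' : ∀ p q r s : Fin 5, p < q → C p q r s = 0 := fun p q r s hpq => by
    rcases lt_trichotomy r s with h | rfl | h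
    · exact key p q r s hpq h
    · rw [← hC.pair_symm, hdiag]
    · rw [hanti', key p q s r hpq h, neg_zero]
  rcases lt_trichotomy p q with h | rfl | h
  · exact key' p q r s h
  · exact hdiag _ _ _
  · rw [hC.antisymm, key' q p r s h, neg_zero]

/-- The `i`-th coordinate of the `p`-th frame vector. -/
def frameCoord (i p : Fin 5) : ℝ := if p = i then 1 else 0

/-- A `3 × 3` matrix, extended by zero to all frame indices. -/
def extendMatrix (Φ : Matrix (Fin 3) (Fin 3) ℝ) (p q : Fin 5) : ℝ :=
  ∑ i : Fin 3, ∑ j : Fin 3, Φ i j * frameCoord i.succ.succ p * frameCoord j.succ.succ q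

/-- The spatial metric in frame components. -/
def spatialMetric (p q : Fin 5) : ℝ :=
  ∑ i : Fin 3, frameCoord i.succ.succ p * frameCoord i.succ.succ q

lemma spatialMetric_comm (p q : Fin 5) : spatialMetric p q = spatialMetric q p := by
  simp only [spatialMetric, mul_comm]

/-- The bivector `ℓ ∧ n` in frame components. -/
def nullWedge (p q : Fin 5) : ℝ :=
  frameCoord 0 p * frameCoord 1 q - frameCoord 1 p * frameCoord 0 q

/-- The spatial Schouten tensor of the boost weight zero Weyl tensor determined by `Φ`. -/
noncomputable def spatialSchouten (Φ : Matrix (Fin 3) (Fin 3) ℝ) (p q : Fin 5) : ℝ :=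
  Φ.trace / 2 * spatialMetric p q - (extendMatrix Φ p q + extendMatrix Φ q p)

/-- The frame components of the boost weight zero Weyl tensor determined by `Φ`. -/
noncomputable def typeDComponents (Φ : Matrix (Fin 3) (Fin 3) ℝ) (p q r s : Fin 5) : ℝ :=
  Φ.trace * nullWedge p q * nullWedge r s
  + nullWedge p q * (extendMatrix Φ r s - extendMatrix Φ s r)
  + (extendMatrix Φ p q - extendMatrix Φ q p) * nullWedge r s
  + (frameCoord 0 p * frameCoord 1 r * extendMatrix Φ q s
    - frameCoord 0 q * frameCoord 1 r * extendMatrix Φ p s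
    - frameCoord 0 p * frameCoord 1 s * extendMatrix Φ q r
    + frameCoord 0 q * frameCoord 1 s * extendMatrix Φ p r)
  + (frameCoord 1 p * frameCoord 0 r * extendMatrix Φ s q
    - frameCoord 1 q * frameCoord 0 r * extendMatrix Φ s p
    - frameCoord 1 p * frameCoord 0 s * extendMatrix Φ r q
    + frameCoord 1 q * frameCoord 0 s * extendMatrix Φ r p)
  + (spatialMetric p r * spatialSchouten Φ q s + spatialMetric q s * spatialSchouten Φ p r
    - spatialMetric p s * spatialSchouten Φ q r - spatialMetric q r * spatialSchouten Φ p s)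

set_option maxHeartbeats 2000000 in
lemma typeDComponents_isWeylComponents (Φ : Matrix (Fin 3) (Fin 3) ℝ) :
    IsWeylComponents (typeDComponents Φ) where
  antisymm p q r s := by
    simp only [typeDComponents, nullWedge, spatialSchouten]
    ring
  pair_symm p q r s := by
    simp only [typeDComponents, nullWedge, spatialSchouten, spatialMetric_comm r,
      spatialMetric_comm s]
    ring
  bianchi p q r s := by
    simp only [typeDComponents, nullWedge, spatialSchouten, spatialMetric_comm s,
      spatialMetric_comm r q]
    ring
  trace q s := by
    fin_cases q <;> fin_cases s <;>
      simp [typeDComponents, nullWedge, spatialSchouten, spatialMetric, extendMatrix, frameCoord,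
        Fin.sum_univ_three, Matrix.trace] <;> ring

lemma typeDComponents_boost (Φ : Matrix (Fin 3) (Fin 3) ℝ) (p q r s : Fin 5)
    (h : bw p + bw q + bw r + bw s ≠ 0) : typeDComponents Φ p q r s = 0 := by
  have hcases : ∀ p : Fin 5, p = 0 ∨ p = 1 ∨
      (frameCoord 0 p = 0 ∧ frameCoord 1 p = 0 ∧ bw p = 0) := by
    intro p
    fin_cases p <;> simp [frameCoord, bw]
  have c00 : frameCoord 0 0 = 1 := by simp [frameCoord]
  have c01 : frameCoord 0 1 = 0 := by simp [frameCoord]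
  have c10 : frameCoord 1 0 = 0 := by simp [frameCoord]
  have c11 : frameCoord 1 1 = 1 := by simp [frameCoord]
  have b0 : bw (0 : Fin 5) = 1 := rfl
  have b1 : bw (1 : Fin 5) = -1 := rfl
  have e0 : ∀ q, extendMatrix Φ 0 q = 0 ∧ extendMatrix Φ 1 q = 0 ∧ extendMatrix Φ q 0 = 0 ∧
      extendMatrix Φ q 1 = 0 := by
    intro q
    simp [extendMatrix, Fin.sum_univ_three, frameCoord]
  have d0 : ∀ q, spatialMetric 0 q = 0 ∧ spatialMetric 1 q = 0 ∧ spatialMetric q 0 = 0 ∧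
      spatialMetric q 1 = 0 := by
    intro q
    simp [spatialMetric, Fin.sum_univ_three, frameCoord]
  rcases hcases p with rfl | rfl | hp <;> rcases hcases q with rfl | rfl | hq <;>
    rcases hcases r with rfl | rfl | hr <;> rcases hcases s with rfl | rfl | hs <;>
    simp_all [typeDComponents, nullWedge, spatialSchouten]

lemma typeDComponents_matrix (Φ : Matrix (Fin 3) (Fin 3) ℝ) (i j : Fin 3) :
    typeDComponents Φ 0 i.succ.succ 1 j.succ.succ = Φ i j := by
  fin_cases i <;> fin_cases j <;>
    simp [typeDComponents, nullWedge, spatialSchouten, spatialMetric, extendMatrix, frameCoord,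
        Fin.sum_univ_three]

/-- The linear map `W ↦ Φ`, `Φ_{ij} = W(ℓ, m_i, n, m_j)`. -/
noncomputable def boostZeroMatrix (f : Fin 5 → Fin 5 → ℝ) :
    weylPure 5 f 0 →ₗ[ℝ] Matrix (Fin 3) (Fin 3) ℝ where
  toFun W := Matrix.of fun i j => W.val.val ![f 0, f i.succ.succ, f 1, f j.succ.succ]
  map_add' _ _ := rfl
  map_smul' _ _ := rfl

lemma boostZeroMatrix_apply (f : Fin 5 → Fin 5 → ℝ) (W : weylPure 5 f 0) (i j : Fin 3) :
    boostZeroMatrix f W i j = W.val.val ![f 0, f i.succ.succ, f 1, f j.succ.succ] :=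
  rfl

lemma boostZeroMatrix_injective {f : Fin 5 → Fin 5 → ℝ} (hf : IsNullFrame f) :
    Function.Injective (boostZeroMatrix f) := by
  intro W W' hWW'
  have hb : ∀ (W : weylPure 5 f 0) (p q r s : Fin 5), bw p + bw q + bw r + bw s ≠ 0 →
      W.val.val ![f p, f q, f r, f s] = 0 := fun W p q r s h => by
    have hW := W.property ![p, q, r, s] (by simpa [Fin.sum_univ_four] using h)
    rwa [comp_vec_four f] at hW
  refine Subtype.ext (Subtype.ext (hf.ext fun p q r s => sub_eq_zero.mp ?_))
  refine ((IsWeyl.components hf W.val.property).sub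
    (IsWeyl.components hf W'.val.property)).eq_zero (fun p q r s h => ?_)
    (fun i j hi hj => ?_) p q r s
  · simp only [hb _ p q r s h, sub_zero]
  · have h := congrFun (congrFun hWW' ⟨i - 2, by omega⟩) ⟨j - 2, by omega⟩
    have hi' : (⟨i - 2, by omega⟩ : Fin 3).succ.succ = i := Fin.ext (by simp; omega)
    have hj' : (⟨j - 2, by omega⟩ : Fin 3).succ.succ = j := Fin.ext (by simp; omega)
    rw [boostZeroMatrix_apply, boostZeroMatrix_apply, hi', hj'] at h
    exact sub_eq_zero.mpr h

lemma boostZeroMatrix_surjective {f : Fin 5 → Fin 5 → ℝ} (hf : IsNullFrame f) :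
    Function.Surjective (boostZeroMatrix f) := by
  intro Φ
  have hW : IsWeyl (hf.ofComponents (typeDComponents Φ)) := by
    refine IsWeylComponents.isWeyl hf ?_
    simp only [hf.ofComponents_apply]
    exact typeDComponents_isWeylComponents Φ
  have hb : ∀ A : Fin 4 → Fin 5, (∑ k, bw (A k)) ≠ 0 →
      hf.ofComponents (typeDComponents Φ) (fun k => f (A k)) = 0 := fun A hA => by
    rw [comp_vec_four f A, hf.ofComponents_apply]
    rw [Fin.sum_univ_four] at hA
    exact typeDComponents_boost Φ _ _ _ _ hA
  refine ⟨⟨⟨_, hW⟩, hb⟩, ?_⟩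
  ext i j
  rw [boostZeroMatrix_apply]
  exact (hf.ofComponents_apply (typeDComponents Φ) 0 i.succ.succ 1 j.succ.succ).trans
    (typeDComponents_matrix Φ i j)

/-- In five dimensions, a Weyl tensor of pure boost weight zero (the
type **D** canonical form) is uniquely determined by the `3×3` matrix
`Φ_{ij} = W(ℓ, m_i, n, m_j)`: the map `W ↦ Φ` is injective on the pure
boost-weight-zero subspace and, both spaces being 9-dimensional, is realized by a
linear isomorphism onto the `3×3` matrices. -/
theorem stmt_8 (f : Fin 5 → Fin 5 → ℝ) (hf : IsNullFrame f) :
    (∀ W W' : weylPure 5 f 0,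
      (∀ i j : Fin 5, 2 ≤ (i : ℕ) → 2 ≤ (j : ℕ) →
        W.val.val ![f 0, f i, f 1, f j] = W'.val.val ![f 0, f i, f 1, f j]) →
      W = W') ∧
    ∃ e : weylPure 5 f 0 ≃ₗ[ℝ] Matrix (Fin 3) (Fin 3) ℝ,
      ∀ (W : weylPure 5 f 0) (i j : Fin 3),
        e W i j = W.val.val ![f 0, f i.succ.succ, f 1, f j.succ.succ] := by
  refine ⟨fun W W' h => boostZeroMatrix_injective hf ?_,
    LinearEquiv.ofBijective (boostZeroMatrix f)
      ⟨boostZeroMatrix_injective hf, boostZeroMatrix_surjective hf⟩, fun _ _ _ => rfl⟩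
  ext i j
  exact h _ _ (by simp) (by simp)
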